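/- arXiv:1408.4728 — 4 statements merged into one kernel-verified Lean document; each statement's English description precedes it below -/
import Mathlib

section
/- Let p ≥ 1 and d > 0. Define α : ℝ^p → ℝ by α(z) = (1/2)·dist(z, S)², where S = {y ∈ ℝ^p : ‖y‖ = d} is the sphere of radius d centered at the origin, and β : ℝ^p → ℝ by β(z) = (1/2)·dist(z, B)², where B = {y ∈ ℝ^p : ‖y‖ ≤ d} is the closed ball of radius d centered at the origin. Then β is the convex envelope of α; that is: (i) β is convex, (ii) β(z) ≤ α(z) for all z ∈ ℝ^p, and (iii) every convex function η : ℝ^p → ℝ satisfying η(z) ≤ α(z) for all z also satisfies η(z) ≤ β(z) for all z. -/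
open Metric in
/-- The distance to a nonempty convex set is a convex function. -/
theorem Convex.convexOn_infDist_univ {E : Type*} [NormedAddCommGroup E] [NormedSpace ℝ E]
    {s : Set E} (hs : Convex ℝ s) (hne : s.Nonempty) :
    ConvexOn ℝ Set.univ (fun z => infDist z s) := by
  refine ⟨convex_univ, fun x _ y _ a b ha hb hab => ?_⟩
  refine le_of_forall_pos_le_add fun ε hε => ?_
  obtain ⟨u, hu, hxu⟩ := (infDist_lt_iff (x := x) hne).1 (lt_add_of_pos_right _ hε)
  obtain ⟨v, hv, hyv⟩ := (infDist_lt_iff (x := y) hne).1 (lt_add_of_pos_right _ hε)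
  calc infDist (a • x + b • y) s
      ≤ dist (a • x + b • y) (a • u + b • v) := infDist_le_dist_of_mem (hs hu hv ha hb hab)
    _ ≤ dist (a • x) (a • u) + dist (b • y) (b • v) := dist_add_add_le _ _ _ _
    _ = a * dist x u + b * dist y v := by
      rw [dist_smul₀, dist_smul₀, Real.norm_of_nonneg ha, Real.norm_of_nonneg hb]
    _ ≤ a * (infDist x s + ε) + b * (infDist y s + ε) := by gcongr
    _ = a * infDist x s + b * infDist y s + (a + b) * ε := by ring
    _ = a • infDist x s + b • infDist y s + ε := by rw [hab, one_mul, smul_eq_mul, smul_eq_mul]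

open Metric in
/-- Outside a ball centered at the origin, the bounding sphere is as close as the ball. -/
theorem infDist_sphere_le_infDist_closedBall {E : Type*} [NormedAddCommGroup E]
    [NormedSpace ℝ E] {d : ℝ} (hd : 0 < d) {z : E} (hz : d ≤ ‖z‖) :
    infDist z {y : E | ‖y‖ = d} ≤ infDist z (closedBall 0 d) := by
  have hz0 : 0 < ‖z‖ := hd.trans_le hz
  have hmem : (d / ‖z‖) • z ∈ {y : E | ‖y‖ = d} := by
    rw [Set.mem_ofPred_eq, norm_smul, Real.norm_of_nonneg (by positivity),
      div_mul_cancel₀ _ hz0.ne']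
  have hdist : dist z ((d / ‖z‖) • z) = ‖z‖ - d := by
    have h : z - (d / ‖z‖) • z = (1 - d / ‖z‖) • z := by rw [sub_smul, one_smul]
    rw [dist_eq_norm, h, norm_smul,
      Real.norm_of_nonneg (sub_nonneg.2 ((div_le_one hz0).2 hz)), sub_mul, one_mul,
      div_mul_cancel₀ _ hz0.ne']
  refine (infDist_le_dist_of_mem hmem).trans ?_
  rw [hdist, le_infDist (nonempty_closedBall.2 hd.le)]
  intro y hy
  rw [mem_closedBall_zero_iff] at hy
  rw [dist_eq_norm]
  linarith [norm_sub_norm_le z y]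


/-- For `p ≥ 1` and `d > 0`, the function
`β(z) = (1/2)·dist(z, B̄(0,d))²` is the convex envelope of
`α(z) = (1/2)·dist(z, S(0,d))²`, where `S(0,d)` is the sphere of radius `d`:
`β` is convex, `β ≤ α`, and any convex underestimator of `α` is below `β`. -/
theorem ball_sq_dist_is_convex_envelope_of_sphere_sq_dist
    (p : ℕ) (hp : 1 ≤ p) (d : ℝ) (hd : 0 < d)
    (α β : EuclideanSpace ℝ (Fin p) → ℝ)
    (hα : ∀ z, α z = (1 / 2) * Metric.infDist z {y : EuclideanSpace ℝ (Fin p) | ‖y‖ = d} ^ 2)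
    (hβ : ∀ z, β z = (1 / 2) * Metric.infDist z (Metric.closedBall (0 : EuclideanSpace ℝ (Fin p)) d) ^ 2) :
    ConvexOn ℝ Set.univ β ∧ (∀ z, β z ≤ α z) ∧
      ∀ η : EuclideanSpace ℝ (Fin p) → ℝ,
        ConvexOn ℝ Set.univ η → (∀ z, η z ≤ α z) → ∀ z, η z ≤ β z := by
  have : Nonempty (Fin p) := ⟨⟨0, hp⟩⟩
  have hsphere : {y : EuclideanSpace ℝ (Fin p) | ‖y‖ = d} = Metric.sphere 0 d := by
    ext y
    simp
  have hball : (Metric.closedBall (0 : EuclideanSpace ℝ (Fin p)) d).Nonempty :=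
    Metric.nonempty_closedBall.2 hd.le
  refine ⟨?_, fun z => ?_, fun η hη hle z => ?_⟩
  · have h := (((convex_closedBall (0 : EuclideanSpace ℝ (Fin p)) d).convexOn_infDist_univ
      hball).pow (fun _ _ => Metric.infDist_nonneg) 2).smul (c := (1 / 2 : ℝ)) (by norm_num)
    exact h.congr fun z _ => (hβ z).symm
  · rw [hα, hβ, hsphere]
    have h := Metric.infDist_le_infDist_of_subset (x := z) Metric.sphere_subset_closedBall
      (NormedSpace.sphere_nonempty (x := (0 : EuclideanSpace ℝ (Fin p))).2 hd.le)
    have := Metric.infDist_nonneg (x := z)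
      (s := Metric.closedBall (0 : EuclideanSpace ℝ (Fin p)) d)
    gcongr
  · rcases le_total d ‖z‖ with hz | hz
    · refine (hle z).trans ?_
      rw [hα, hβ]
      have := Metric.infDist_nonneg (x := z) (s := {y : EuclideanSpace ℝ (Fin p) | ‖y‖ = d})
      gcongr
      exact infDist_sphere_le_infDist_closedBall hd hz
    · have hmem : z ∈ convexHull ℝ (Metric.sphere (0 : EuclideanSpace ℝ (Fin p)) d) := by
        rwa [convexHull_sphere_eq_closedBall _ hd.le, mem_closedBall_zero_iff]
      obtain ⟨y, hy, hzy⟩ := hη.exists_ge_of_mem_convexHull (Set.subset_univ _) hmem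
      have hαy : α y = 0 := by
        rw [hα, hsphere, Metric.infDist_zero_of_mem hy]
        norm_num
      have hβz : 0 ≤ β z := by
        rw [hβ]
        positivity
      linarith [hle y]
end

section
/- Let p ≥ 1 and d > 0. Define α : ℝ^p → ℝ by α(z) = (1/2)·inf{‖z − y‖² : ‖y‖ = d}. Then for every s ∈ ℝ^p, the Fenchel conjugate of α at s satisfies sup{⟨s, z⟩ − α(z) : z ∈ ℝ^p} = (1/2)‖s‖² + d‖s‖. -/
open scoped RealInnerProductSpace

section SphereSqDist

variable {E : Type*} [NormedAddCommGroup E] [InnerProductSpace ℝ E]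

/-- Cauchy–Schwarz is attained on every sphere of nonnegative radius. -/
theorem exists_norm_eq_and_inner_eq_mul_norm [Nontrivial E] {d : ℝ} (hd : 0 ≤ d) (s : E) :
    ∃ y : E, ‖y‖ = d ∧ ⟪s, y⟫ = d * ‖s‖ := by
  rcases eq_or_ne s 0 with rfl | hs
  · obtain ⟨y, hy⟩ := exists_norm_eq E hd
    exact ⟨y, hy, by simp⟩
  · have hs' : ‖s‖ ≠ 0 := norm_ne_zero_iff.mpr hs
    refine ⟨(d / ‖s‖) • s, ?_, ?_⟩
    · rw [norm_smul, Real.norm_of_nonneg (by positivity), div_mul_cancel₀ _ hs']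
    · rw [real_inner_smul_right, real_inner_self_eq_norm_sq]
      field_simp

/-- Young's inequality for the inner product, with the quadratic centred at `y`. -/
theorem real_inner_sub_half_norm_sub_sq_le (s y z : E) :
    ⟪s, z⟫ - (1 / 2) * ‖z - y‖ ^ 2 ≤ (1 / 2) * ‖s‖ ^ 2 + ‖y‖ * ‖s‖ := by
  have hy : ⟪s, y⟫ ≤ ‖s‖ * ‖y‖ := real_inner_le_norm s y
  have hzy : ⟪s, z - y⟫ ≤ ‖s‖ * ‖z - y‖ := real_inner_le_norm s (z - y)
  rw [inner_sub_right] at hzy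
  nlinarith [sq_nonneg (‖s‖ - ‖z - y‖)]

end SphereSqDist

/-- For `p ≥ 1`, `d > 0` and
`α(z) = (1/2)·inf{‖z - y‖² : ‖y‖ = d}`, the Fenchel conjugate of `α` satisfies
`α*(s) = sup_z (⟪s, z⟫ - α z) = (1/2)‖s‖² + d‖s‖` for every `s`. -/
theorem fenchel_conjugate_of_sphere_sq_dist
    (p : ℕ) (hp : 1 ≤ p) (d : ℝ) (hd : 0 < d)
    (α : EuclideanSpace ℝ (Fin p) → ℝ)
    (hα : ∀ z, α z =
      (1 / 2) * sInf ((fun y : EuclideanSpace ℝ (Fin p) => ‖z - y‖ ^ 2) ''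
        {y : EuclideanSpace ℝ (Fin p) | ‖y‖ = d})) :
    ∀ s : EuclideanSpace ℝ (Fin p),
      IsLUB (Set.range fun z : EuclideanSpace ℝ (Fin p) => ⟪s, z⟫ - α z)
        ((1 / 2) * ‖s‖ ^ 2 + d * ‖s‖) := by
  intro s
  have : Nonempty (Fin p) := ⟨⟨0, hp⟩⟩
  obtain ⟨y₀, hy₀, hsy₀⟩ := exists_norm_eq_and_inner_eq_mul_norm hd.le s
  have upper : ∀ z, ⟪s, z⟫ - α z ≤ (1 / 2) * ‖s‖ ^ 2 + d * ‖s‖ := by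
    intro z
    have key : 2 * (⟪s, z⟫ - ((1 / 2) * ‖s‖ ^ 2 + d * ‖s‖)) ≤
        sInf ((fun y : EuclideanSpace ℝ (Fin p) => ‖z - y‖ ^ 2) '' {y | ‖y‖ = d}) := by
      refine le_csInf ⟨_, y₀, hy₀, rfl⟩ ?_
      rintro _ ⟨y, rfl, rfl⟩
      linarith [real_inner_sub_half_norm_sub_sq_le s y z]
    rw [hα]
    linarith
  refine IsGreatest.isLUB ⟨⟨y₀ + s, le_antisymm (upper _) ?_⟩, Set.forall_mem_range.mpr upper⟩
  have hle : sInf ((fun y : EuclideanSpace ℝ (Fin p) => ‖y₀ + s - y‖ ^ 2) '' {y | ‖y‖ = d}) ≤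
      ‖s‖ ^ 2 := by
    refine csInf_le ⟨0, ?_⟩ ⟨y₀, hy₀, by simp⟩
    rintro _ ⟨y, -, rfl⟩
    positivity
  simp only [hα, inner_add_right, real_inner_self_eq_norm_sq, hsy₀]
  linarith
end

section
/- Let H be a real Hilbert space and f : H → ℝ a convex differentiable function whose gradient is Lipschitz continuous with constant L > 0, attaining its minimum at some x* ∈ H. Let x₀ ∈ H and define sequences by x(−1) = x(0) = x₀ and, for k ≥ 1, w(k) = x(k−1) + ((k−2)/(k+1))·(x(k−1) − x(k−2)) and x(k) = w(k) − (1/L)·∇f(w(k)). Then for every k ≥ 1, f(x(k)) − f(x*) ≤ 2L·‖x₀ − x*‖² / (k+1)². -/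
section NesterovAuxiliary

variable {H : Type*} [NormedAddCommGroup H] [InnerProductSpace ℝ H] [CompleteSpace H]

theorem HasGradientAt.hasDerivAt_comp_add_smul {f : H → ℝ} {g u d : H} {t : ℝ}
    (h : HasGradientAt f g (u + t • d)) :
    HasDerivAt (fun s : ℝ => f (u + s • d)) (inner ℝ g d) t := by
  have hline : HasDerivAt (fun s : ℝ => u + s • d) d t := by
    simpa using ((hasDerivAt_id t).smul_const d).const_add u
  simpa [Function.comp_def] using h.hasFDerivAt.comp_hasDerivAt t hline

/-- First-order condition for convexity. -/
theorem ConvexOn.add_inner_le_of_hasGradientAt {f : H → ℝ} (hf : ConvexOn ℝ Set.univ f)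
    {g u : H} (hg : HasGradientAt f g u) (z : H) :
    f u + inner ℝ g (z - u) ≤ f z := by
  have hconv : ConvexOn ℝ Set.univ (fun s : ℝ => f (u + s • (z - u))) := by
    have h := hf.comp_affineMap (AffineMap.lineMap (k := ℝ) u z)
    simpa [Function.comp_def, AffineMap.lineMap_apply, add_comm] using h
  have hder : HasDerivAt (fun s : ℝ => f (u + s • (z - u))) (inner ℝ g (z - u)) 0 :=
    HasGradientAt.hasDerivAt_comp_add_smul (by simpa using hg)
  have h := hconv.le_slope_of_hasDerivAt (Set.mem_univ 0) (Set.mem_univ 1) one_pos hder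
  simp [slope_def_field] at h
  linarith

/-- The descent lemma for functions with Lipschitz gradient. -/
theorem le_add_inner_add_sq_of_lipschitz_gradient {f : H → ℝ} {f' : H → H} {L : ℝ}
    (hgrad : ∀ z, HasGradientAt f (f' z) z)
    (hlip : ∀ u v, ‖f' u - f' v‖ ≤ L * ‖u - v‖) (u d : H) :
    f (u + d) ≤ f u + inner ℝ (f' u) d + L / 2 * ‖d‖ ^ 2 := by
  have hf (t : ℝ) : HasDerivAt (fun s : ℝ => f (u + s • d)) (inner ℝ (f' (u + t • d)) d) t :=
    (hgrad _).hasDerivAt_comp_add_smul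
  have hB (t : ℝ) : HasDerivAt
      (fun s : ℝ => f u + s * inner ℝ (f' u) d + L / 2 * ‖d‖ ^ 2 * s ^ 2)
      (inner ℝ (f' u) d + L * ‖d‖ ^ 2 * t) t := by
    refine ((((hasDerivAt_id' t).mul_const (inner ℝ (f' u) d)).const_add (f u)).add
      ((hasDerivAt_pow 2 t).const_mul (L / 2 * ‖d‖ ^ 2))).congr_deriv ?_
    push_cast
    ring
  have hbound (t : ℝ) (ht : 0 ≤ t) :
      inner ℝ (f' (u + t • d)) d ≤ inner ℝ (f' u) d + L * ‖d‖ ^ 2 * t := by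
    have h : inner ℝ (f' (u + t • d) - f' u) d ≤ L * ‖d‖ ^ 2 * t := calc
      inner ℝ (f' (u + t • d) - f' u) d ≤ ‖f' (u + t • d) - f' u‖ * ‖d‖ :=
        real_inner_le_norm _ _
      _ ≤ L * ‖u + t • d - u‖ * ‖d‖ := by gcongr; exact hlip _ _
      _ = L * ‖d‖ ^ 2 * t := by
        rw [add_sub_cancel_left, norm_smul, Real.norm_of_nonneg ht]; ring
    rw [inner_sub_left] at h
    linarith
  have h := image_le_of_deriv_right_le_deriv_boundary (a := 0) (b := 1)
    (fun t _ => (hf t).continuousAt.continuousWithinAt)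
    (fun t _ => (hf t).hasDerivWithinAt) (by simp)
    (fun t _ => (hB t).continuousAt.continuousWithinAt)
    (fun t _ => (hB t).hasDerivWithinAt) (fun t ht => hbound t ht.1)
    (Set.right_mem_Icc.2 zero_le_one)
  simpa using h

theorem ConvexOn.gradient_step_le {f : H → ℝ} {f' : H → H} {L : ℝ} (hL : 0 < L)
    (hconv : ConvexOn ℝ Set.univ f) (hgrad : ∀ z, HasGradientAt f (f' z) z)
    (hlip : ∀ u v, ‖f' u - f' v‖ ≤ L * ‖u - v‖) (w z : H) :
    f (w - (1 / L) • f' w) ≤ f z + inner ℝ (f' w) (w - z) - 1 / (2 * L) * ‖f' w‖ ^ 2 := by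
  have hdesc := le_add_inner_add_sq_of_lipschitz_gradient hgrad hlip w (-((1 / L) • f' w))
  have hfirst := hconv.add_inner_le_of_hasGradientAt (hgrad w) z
  rw [← sub_eq_add_neg, inner_neg_right, inner_smul_right, real_inner_self_eq_norm_sq, norm_neg,
    norm_smul, Real.norm_of_nonneg (by positivity)] at hdesc
  rw [← neg_sub w z, inner_neg_right] at hfirst
  have hcoef : L / 2 * (1 / L * ‖f' w‖) ^ 2 - 1 / L * ‖f' w‖ ^ 2
      = -(1 / (2 * L) * ‖f' w‖ ^ 2) := by
    field_simp
    ring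
  linarith

/-- One step of accelerated gradient descent with parameter `θ` and mirror point `v`. -/
theorem ConvexOn.accelerated_gradient_step_le {f : H → ℝ} {f' : H → H} {L θ : ℝ} (hL : 0 < L)
    (hθ : 0 < θ) (hθ1 : θ ≤ 1)
    (hconv : ConvexOn ℝ Set.univ f) (hgrad : ∀ z, HasGradientAt f (f' z) z)
    (hlip : ∀ u v, ‖f' u - f' v‖ ≤ L * ‖u - v‖) {a v w : H} (p : H)
    (hw : w = (1 - θ) • a + θ • v) :
    f (w - (1 / L) • f' w) - f p + L * θ ^ 2 / 2 * ‖v - (1 / (θ * L)) • f' w - p‖ ^ 2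
      ≤ (1 - θ) * (f a - f p) + L * θ ^ 2 / 2 * ‖v - p‖ ^ 2 := by
  have ha := mul_le_mul_of_nonneg_left (hconv.gradient_step_le hL hgrad hlip w a)
    (sub_nonneg.2 hθ1)
  have hp := mul_le_mul_of_nonneg_left (hconv.gradient_step_le hL hgrad hlip w p) hθ.le
  have hinner : (1 - θ) * inner ℝ (f' w) (w - a) + θ * inner ℝ (f' w) (w - p)
      = θ * inner ℝ (f' w) (v - p) := by
    simp only [← real_inner_smul_right, ← inner_add_right]
    congr 1
    nth_rewrite 1 [hw]
    nth_rewrite 1 [hw]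
    module
  have hnorm : L * θ ^ 2 / 2 * ‖v - (1 / (θ * L)) • f' w - p‖ ^ 2
      = L * θ ^ 2 / 2 * ‖v - p‖ ^ 2 - θ * inner ℝ (f' w) (v - p)
        + 1 / (2 * L) * ‖f' w‖ ^ 2 := by
    rw [sub_right_comm, norm_sub_sq_real, inner_smul_right, norm_smul,
      Real.norm_of_nonneg (by positivity), real_inner_comm]
    field_simp
  linarith

end NesterovAuxiliary

/-- Nesterov's accelerated gradient method: for a convex differentiable
`f` with `L`-Lipschitz gradient minimized at `x*`, the iterates
`w(k) = x(k−1) + ((k−2)/(k+1))(x(k−1) − x(k−2))`, `x(k) = w(k) − (1/L)∇f(w(k))`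
(with `x(−1) = x(0) = x₀`) satisfy `f(x(k)) − f(x*) ≤ 2L‖x₀ − x*‖²/(k+1)²`.
(Since `x(−1) = x(0)`, truncated subtraction `k - 2` on `ℕ` indices agrees with the
integer-indexed recursion.) -/
theorem nesterov_accelerated_gradient_rate
    {H : Type*} [NormedAddCommGroup H] [InnerProductSpace ℝ H] [CompleteSpace H]
    (f : H → ℝ) (f' : H → H) (L : ℝ) (hL : 0 < L)
    (hconv : ConvexOn ℝ Set.univ f)
    (hgrad : ∀ z : H, HasGradientAt f (f' z) z)
    (hlip : ∀ u v : H, ‖f' u - f' v‖ ≤ L * ‖u - v‖)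
    (xstar : H) (hmin : ∀ z : H, f xstar ≤ f z)
    (x0 : H) (x w : ℕ → H)
    (hx0 : x 0 = x0)
    (hw : ∀ k : ℕ, 1 ≤ k →
      w k = x (k - 1) + (((k : ℝ) - 2) / ((k : ℝ) + 1)) • (x (k - 1) - x (k - 2)))
    (hx : ∀ k : ℕ, 1 ≤ k → x k = w k - (1 / L) • f' (w k)) :
    ∀ k : ℕ, 1 ≤ k →
      f (x k) - f xstar ≤ 2 * L * ‖x0 - xstar‖ ^ 2 / ((k : ℝ) + 1) ^ 2 := by
  set v : ℕ → H := fun n => x (n - 1) + (((n : ℝ) + 1) / 2) • (x n - x (n - 1)) with hv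
  have hwv (n : ℕ) : w (n + 1)
      = (1 - 2 / ((n : ℝ) + 2)) • x n + (2 / ((n : ℝ) + 2)) • v n := by
    rw [hw (n + 1) (by omega)]
    simp only [hv, Nat.add_sub_cancel, show n + 1 - 2 = n - 1 by omega]
    push_cast
    match_scalars <;> field_simp <;> ring
  have hvv (n : ℕ) : v (n + 1)
      = v n - (1 / (2 / ((n : ℝ) + 2) * L)) • f' (w (n + 1)) := by
    have hxn : x (n + 1) = (1 - 2 / ((n : ℝ) + 2)) • x n + (2 / ((n : ℝ) + 2)) • v n
        - (1 / L) • f' (w (n + 1)) := by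
      rw [hx (n + 1) (by omega), ← hwv]
    have hvn : v (n + 1) = x n + (((n : ℝ) + 2) / 2) • (x (n + 1) - x n) := by
      simp only [hv, Nat.add_sub_cancel]
      push_cast
      ring_nf
    rw [hvn, hxn]
    match_scalars <;> field_simp <;> ring
  have hstep (n : ℕ) :
      ((n : ℝ) + 2) ^ 2 / 4 * (f (x (n + 1)) - f xstar) + L / 2 * ‖v (n + 1) - xstar‖ ^ 2
        ≤ (n : ℝ) * (n + 2) / 4 * (f (x n) - f xstar) + L / 2 * ‖v n - xstar‖ ^ 2 := by
    have hθ1 : 2 / ((n : ℝ) + 2) ≤ 1 := by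
      rw [div_le_one (by positivity)]
      linarith [n.cast_nonneg (α := ℝ)]
    have h := hconv.accelerated_gradient_step_le hL (by positivity) hθ1 hgrad hlip xstar (hwv n)
    rw [← hx (n + 1) (by omega), ← hvv] at h
    have h' := mul_le_mul_of_nonneg_left h (show 0 ≤ ((n : ℝ) + 2) ^ 2 / 4 by positivity)
    refine (le_of_eq ?_).trans (h'.trans_eq ?_) <;> field_simp <;> ring
  have hpot (n : ℕ) : (n : ℝ) * (n + 2) / 4 * (f (x n) - f xstar)
      + L / 2 * ‖v n - xstar‖ ^ 2 ≤ L / 2 * ‖x0 - xstar‖ ^ 2 := by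
    induction n with
    | zero => simp [hv, hx0]
    | succ n ih =>
      refine le_trans ?_ ((hstep n).trans ih)
      have hgap := sub_nonneg.2 (hmin (x (n + 1)))
      gcongr
      push_cast
      nlinarith
  intro k hk
  obtain ⟨n, rfl⟩ := Nat.exists_eq_add_of_le' hk
  have h := (hstep n).trans (hpot n)
  have hv_nonneg : 0 ≤ L / 2 * ‖v (n + 1) - xstar‖ ^ 2 := by positivity
  rw [le_div_iff₀ (by positivity)]
  push_cast
  linarith
end

section
/- Let N ≥ 1 and F : ℝ^N → ℝ be convex, differentiable, and coercive, with infimum F* = inf F and nonempty minimizer set X* = {x : F(x) = F*}. Let (x(k))_{k∈ℕ} be a sequence in ℝ^N such that the sequence (F(x(k)))_k is nonincreasing and ∇F(x(k)) → 0 as k → ∞. Then F(x(k)) → F*, and there exists a subsequence (x(k_l)) converging to a point y ∈ X*. -/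
/-- The first-order characterization of convexity: a convex function lies above its tangent
hyperplanes. -/
theorem ConvexOn.add_inner_gradient_le {E : Type*} [NormedAddCommGroup E] [InnerProductSpace ℝ E]
    [CompleteSpace E] {F : E → ℝ} (hF : ConvexOn ℝ Set.univ F) {a : E}
    (ha : DifferentiableAt ℝ F a) (b : E) :
    F a + inner ℝ (gradient F a) (b - a) ≤ F b := by
  have hg : ConvexOn ℝ Set.univ (F ∘ AffineMap.lineMap (k := ℝ) a b) := by
    simpa using hF.comp_affineMap (AffineMap.lineMap (k := ℝ) a b)
  have hd : HasDerivAt (F ∘ AffineMap.lineMap (k := ℝ) a b) (inner ℝ (gradient F a) (b - a)) 0 := by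
    have hFa : HasFDerivAt F (InnerProductSpace.toDual ℝ E (gradient F a))
        (AffineMap.lineMap (k := ℝ) a b 0) := by
      simpa using ha.hasGradientAt.hasFDerivAt
    simpa using hFa.comp_hasDerivAt (0 : ℝ) AffineMap.hasDerivAt_lineMap
  have h := hg.le_slope_of_hasDerivAt (Set.mem_univ 0) (Set.mem_univ 1) one_pos hd
  simp only [slope_def_field, Function.comp_apply, AffineMap.lineMap_apply_one,
    AffineMap.lineMap_apply_zero, sub_zero, div_one] at h
  linarith

/-- Let `F : ℝ^N → ℝ` be convex, differentiable and coercive, with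
nonempty minimizer set. If `(x k)` is a sequence along which `F` is nonincreasing and
`∇F(x k) → 0`, then `F(x k) → inf F` and some subsequence of `(x k)` converges to a
minimizer of `F`. -/
theorem descent_sequence_with_vanishing_gradient_converges
    (N : ℕ) (hN : 1 ≤ N)
    (F : EuclideanSpace ℝ (Fin N) → ℝ)
    (hconv : ConvexOn ℝ Set.univ F)
    (hdiff : Differentiable ℝ F)
    (hcoer : Filter.Tendsto F
      (Filter.comap (fun x : EuclideanSpace ℝ (Fin N) => ‖x‖) Filter.atTop) Filter.atTop)
    (hXne : ∃ z, ∀ w, F z ≤ F w)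
    (x : ℕ → EuclideanSpace ℝ (Fin N))
    (hdec : ∀ k : ℕ, F (x (k + 1)) ≤ F (x k))
    (hgrad0 : Filter.Tendsto (fun k => gradient F (x k)) Filter.atTop (nhds 0)) :
    Filter.Tendsto (fun k => F (x k)) Filter.atTop (nhds (⨅ z, F z)) ∧
      ∃ (y : EuclideanSpace ℝ (Fin N)) (φ : ℕ → ℕ), (∀ w, F y ≤ F w) ∧ StrictMono φ ∧
        Filter.Tendsto (x ∘ φ) Filter.atTop (nhds y) := by
  obtain ⟨z, hz⟩ := hXne
  have hinf : ⨅ w, F w = F z :=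
    le_antisymm (ciInf_le ⟨F z, Set.forall_mem_range.2 hz⟩ z) (le_ciInf hz)
  have hanti : Antitone fun k => F (x k) := antitone_nat_of_succ_le hdec
  have hbdd : Bornology.IsBounded {w | F w ≤ F (x 0)} := by
    rw [comap_norm_atTop] at hcoer
    have h := hcoer.eventually_gt_atTop (F (x 0))
    rw [Bornology.isBounded_def]
    filter_upwards [h] with w hw using not_le.2 hw
  have hmem : ∀ k, x k ∈ {w | F w ≤ F (x 0)} := fun k => hanti (Nat.zero_le k)
  obtain ⟨C, hC⟩ := hbdd.exists_norm_le
  have hlim : Filter.Tendsto (fun k => F (x k)) Filter.atTop (nhds (F z)) := by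
    have hupper : ∀ k, F (x k) ≤ F z + ‖gradient F (x k)‖ * (‖z‖ + C) := fun k => by
      have h₁ := hconv.add_inner_gradient_le (hdiff (x k)) z
      have h₂ := (abs_le.1 (abs_real_inner_le_norm (gradient F (x k)) (z - x k))).1
      have h₃ : ‖z - x k‖ ≤ ‖z‖ + C :=
        (norm_sub_le _ _).trans (add_le_add_right (hC _ (hmem k)) _)
      have h₄ := mul_le_mul_of_nonneg_left h₃ (norm_nonneg (gradient F (x k)))
      linarith
    refine tendsto_of_tendsto_of_tendsto_of_le_of_le tendsto_const_nhds ?_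
      (fun k => hz (x k)) hupper
    simpa using (hgrad0.norm.mul_const (‖z‖ + C)).const_add (F z)
  obtain ⟨y, -, φ, hφ, hy⟩ := tendsto_subseq_of_bounded hbdd hmem
  have hFy : F y = F z := tendsto_nhds_unique
    ((hdiff.continuous.tendsto y).comp hy) (hlim.comp hφ.tendsto_atTop)
  exact ⟨hinf ▸ hlim, y, φ, fun w => hFy ▸ hz w, hφ, hy⟩
end
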